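/- Fix δ ∈ (1/2, ∞), and for each SNR > 0 let τ*(SNR) be the unique positive minimizer of F (with parameters δ and SNR). Then lim_{SNR → +∞} Q(1/τ*(SNR)) / Q(√((δ − 1/2)·SNR)) = 1; in particular, for every ε > 0 there exists SNR₀ such that |Q(1/τ*(SNR))/Q(√((δ − 1/2)·SNR)) − 1| ≤ ε for all SNR ≥ SNR₀. -/

import Mathlib

open Real

/-- The standard normal tail function `Q(x) = ∫_x^∞ (2π)^{-1/2} e^{-t²/2} dt`. -/
noncomputable def Qfun (x : ℝ) : ℝ :=
  ∫ t in Set.Ioi x, (Real.sqrt (2 * Real.pi))⁻¹ * Real.exp (-t ^ 2 / 2)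

/-- The function `F` from the paper, with parameters `δ` and `SNR`. -/
noncomputable def Ffun (δ SNR τ : ℝ) : ℝ :=
  τ * (δ - 1 / 2) + (1 / SNR) / τ + (τ + 4 / τ) * Qfun (2 / τ)
    - Real.sqrt (2 / Real.pi) * Real.exp (-2 / τ ^ 2)

/-- The standard normal density. -/
noncomputable def stdNormalDensity (t : ℝ) : ℝ :=
  (Real.sqrt (2 * Real.pi))⁻¹ * Real.exp (-t ^ 2 / 2)

lemma stdNormalDensity_pos (t : ℝ) : 0 < stdNormalDensity t := by
  unfold stdNormalDensity
  positivity

lemma continuous_stdNormalDensity : Continuous stdNormalDensity := by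
  unfold stdNormalDensity
  fun_prop

lemma integrable_stdNormalDensity : MeasureTheory.Integrable stdNormalDensity := by
  have h := (integrable_exp_neg_mul_sq (b := 1 / 2) (by norm_num)).const_mul
    (Real.sqrt (2 * Real.pi))⁻¹
  refine h.congr (Filter.Eventually.of_forall fun t => ?_)
  simp only [stdNormalDensity]
  ring_nf

lemma stdNormalDensity_le_of_le {a t : ℝ} (ha : 0 ≤ a) (hat : a ≤ t) :
    stdNormalDensity t ≤ stdNormalDensity a := by
  unfold stdNormalDensity
  gcongr

lemma hasDerivAt_stdNormalDensity (t : ℝ) :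
    HasDerivAt stdNormalDensity (-(t * stdNormalDensity t)) t := by
  have h : HasDerivAt (fun t : ℝ => -t ^ 2 / 2) (-t) t := by
    have := ((hasDerivAt_pow 2 t).neg).div_const 2
    refine this.congr_deriv ?_
    norm_num
    ring
  refine (h.exp.const_mul (Real.sqrt (2 * Real.pi))⁻¹).congr_deriv ?_
  unfold stdNormalDensity
  ring

lemma tendsto_stdNormalDensity_atTop :
    Filter.Tendsto stdNormalDensity Filter.atTop (nhds 0) := by
  have h : Filter.Tendsto (fun t : ℝ => t ^ 2 / 2) Filter.atTop Filter.atTop :=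
    (Filter.tendsto_pow_atTop two_ne_zero).atTop_div_const two_pos
  have := (Real.tendsto_exp_neg_atTop_nhds_zero.comp h).const_mul (Real.sqrt (2 * Real.pi))⁻¹
  rw [mul_zero] at this
  refine this.congr fun t => ?_
  simp [stdNormalDensity, neg_div]

lemma stdNormalDensity_le_exp_neg {t : ℝ} (ht : 2 ≤ t) :
    stdNormalDensity t ≤ Real.exp (-t) := by
  have h1 : (Real.sqrt (2 * Real.pi))⁻¹ ≤ 1 := by
    apply inv_le_one_of_one_le₀
    rw [Real.one_le_sqrt]
    nlinarith [Real.pi_gt_three]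
  have h2 : Real.exp (-t ^ 2 / 2) ≤ Real.exp (-t) := Real.exp_le_exp.2 (by nlinarith)
  calc stdNormalDensity t ≤ 1 * Real.exp (-t) := by
        unfold stdNormalDensity
        gcongr
    _ = _ := one_mul _

lemma Qfun_eq_setIntegral (x : ℝ) : Qfun x = ∫ t in Set.Ioi x, stdNormalDensity t := rfl

lemma Qfun_sub_Qfun (a b : ℝ) : Qfun a - Qfun b = ∫ t in a..b, stdNormalDensity t :=
  (intervalIntegral.integral_Ioi_sub_Ioi' integrable_stdNormalDensity.integrableOn
    integrable_stdNormalDensity.integrableOn)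

lemma Qfun_nonneg (x : ℝ) : 0 ≤ Qfun x :=
  MeasureTheory.integral_nonneg fun t => (stdNormalDensity_pos t).le

lemma hasDerivAt_Qfun (x : ℝ) : HasDerivAt Qfun (-stdNormalDensity x) x := by
  have h : HasDerivAt (fun u => ∫ t in (0 : ℝ)..u, stdNormalDensity t) (stdNormalDensity x) x :=
    (continuous_stdNormalDensity.integral_hasStrictDerivAt 0 x).hasDerivAt
  refine (h.const_sub (Qfun 0)).congr_of_eventuallyEq (Filter.Eventually.of_forall fun u => ?_)
  simp only [← Qfun_sub_Qfun, sub_sub_cancel]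

lemma Qfun_sub_Qfun_le {a b : ℝ} (ha : 0 ≤ a) (hab : a ≤ b) :
    Qfun a - Qfun b ≤ (b - a) * stdNormalDensity a := by
  rw [Qfun_sub_Qfun]
  calc ∫ t in a..b, stdNormalDensity t ≤ ∫ _ in a..b, stdNormalDensity a :=
        intervalIntegral.integral_mono_on hab
          (continuous_stdNormalDensity.intervalIntegrable _ _) (by simp)
          fun t ht => stdNormalDensity_le_of_le ha ht.1
    _ = _ := by simp

lemma le_Qfun_sub_Qfun {a b : ℝ} (ha : 0 ≤ a) (hab : a ≤ b) :
    (b - a) * stdNormalDensity b ≤ Qfun a - Qfun b := by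
  rw [Qfun_sub_Qfun]
  calc _ = ∫ _ in a..b, stdNormalDensity b := by simp
    _ ≤ ∫ t in a..b, stdNormalDensity t :=
        intervalIntegral.integral_mono_on hab (by simp)
          (continuous_stdNormalDensity.intervalIntegrable _ _)
          fun t ht => stdNormalDensity_le_of_le (ha.trans ht.1) ht.2

lemma mul_Qfun_le {y : ℝ} (hy : 0 ≤ y) : y * Qfun y ≤ stdNormalDensity y := by
  have hd : ∀ t ∈ Set.Ici y,
      HasDerivAt (fun t => -stdNormalDensity t) (t * stdNormalDensity t) t := fun t _ => by
    simpa using (hasDerivAt_stdNormalDensity t).fun_neg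
  have hnn : ∀ t ∈ Set.Ioi y, 0 ≤ t * stdNormalDensity t := fun t ht =>
    mul_nonneg (hy.trans ht.le) (stdNormalDensity_pos t).le
  have hlim : Filter.Tendsto (fun t => -stdNormalDensity t) Filter.atTop (nhds 0) := by
    simpa using tendsto_stdNormalDensity_atTop.neg
  have hint := MeasureTheory.integrableOn_Ioi_deriv_of_nonneg' hd hnn hlim
  have hval := MeasureTheory.integral_Ioi_of_hasDerivAt_of_nonneg' hd hnn hlim
  calc y * Qfun y = ∫ t in Set.Ioi y, y * stdNormalDensity t := by
        rw [Qfun_eq_setIntegral, MeasureTheory.integral_const_mul]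
    _ ≤ ∫ t in Set.Ioi y, t * stdNormalDensity t := by
        refine MeasureTheory.setIntegral_mono_on
          (integrable_stdNormalDensity.const_mul y).integrableOn hint measurableSet_Ioi
          fun t ht => ?_
        exact mul_le_mul_of_nonneg_right (Set.mem_Ioi.1 ht).le (stdNormalDensity_pos t).le
    _ = stdNormalDensity y := by rw [hval]; ring

lemma stdNormalDensity_le_mul_Qfun {a : ℝ} (ha : 1 ≤ a) :
    stdNormalDensity a ≤ Real.exp (3 / 2) * (a * Qfun a) := by
  have ha0 : 0 < a := by linarith
  have h1 := le_Qfun_sub_Qfun (b := a + a⁻¹) ha0.le (by simp [ha0.le])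
  have h2 : stdNormalDensity a ≤ Real.exp (3 / 2) * stdNormalDensity (a + a⁻¹) := by
    unfold stdNormalDensity
    rw [mul_left_comm, ← Real.exp_add]
    gcongr
    have hinv : a⁻¹ ≤ 1 := inv_le_one_of_one_le₀ ha
    have hinv0 : 0 < a⁻¹ := by positivity
    have : a * a⁻¹ = 1 := mul_inv_cancel₀ ha0.ne'
    nlinarith
  have h3 : stdNormalDensity (a + a⁻¹) ≤ a * Qfun a := by
    have h4 : a⁻¹ * stdNormalDensity (a + a⁻¹) ≤ Qfun a := by
      have := Qfun_nonneg (a + a⁻¹)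
      rw [add_sub_cancel_left] at h1
      linarith
    calc _ = a * (a⁻¹ * stdNormalDensity (a + a⁻¹)) := by field_simp
      _ ≤ _ := by gcongr
  exact h2.trans (by gcongr)

lemma Qfun_pos {a : ℝ} (ha : 1 ≤ a) : 0 < Qfun a := by
  have h := (stdNormalDensity_pos a).trans_le (stdNormalDensity_le_mul_Qfun ha)
  exact pos_of_mul_pos_right (pos_of_mul_pos_right h (by positivity)) (by positivity)

/-- Relative stability of `Qfun` in terms of the squares of its arguments. -/
lemma abs_Qfun_div_Qfun_sub_one_le {a x : ℝ} (ha : 1 ≤ a) (hax : a ≤ x) :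
    |Qfun x / Qfun a - 1| ≤ Real.exp (3 / 2) * (x ^ 2 - a ^ 2) := by
  have hQ := Qfun_pos ha
  have h0 : 0 ≤ Qfun a - Qfun x := by
    refine le_trans ?_ (le_Qfun_sub_Qfun (by linarith) hax)
    exact mul_nonneg (by linarith) (stdNormalDensity_pos x).le
  rw [abs_sub_comm, one_sub_div hQ.ne', abs_of_nonneg (by positivity), div_le_iff₀ hQ]
  calc Qfun a - Qfun x ≤ (x - a) * stdNormalDensity a := Qfun_sub_Qfun_le (by linarith) hax
    _ ≤ (x - a) * (Real.exp (3 / 2) * (a * Qfun a)) := by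
        have := stdNormalDensity_le_mul_Qfun ha
        have : 0 ≤ x - a := by linarith
        gcongr
    _ = Real.exp (3 / 2) * Qfun a * ((x - a) * a) := by ring
    _ ≤ Real.exp (3 / 2) * Qfun a * (x ^ 2 - a ^ 2) := by
        gcongr
        nlinarith
    _ = _ := by ring

/-- The derivative at `τ = 2 / y` of the part of `Ffun` not depending on its parameters. -/
noncomputable def tailSlope (y : ℝ) : ℝ := (1 - y ^ 2) * Qfun y + y * stdNormalDensity y

lemma tailSlope_nonneg {y : ℝ} (hy : 0 ≤ y) : 0 ≤ tailSlope y := by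
  have h1 := mul_le_mul_of_nonneg_left (mul_Qfun_le hy) hy
  have h2 := Qfun_nonneg y
  unfold tailSlope
  nlinarith

lemma sq_mul_tailSlope_le {y : ℝ} (hy : 2 ≤ y) :
    y ^ 2 * tailSlope y ≤ 2 * (y ^ 3 * Real.exp (-y)) := by
  have hφ := stdNormalDensity_le_exp_neg hy
  have hQ := Qfun_nonneg y
  have hM := mul_Qfun_le (show 0 ≤ y by linarith)
  have h1 : tailSlope y ≤ 2 * (y * stdNormalDensity y) := by
    have := stdNormalDensity_pos y
    unfold tailSlope
    nlinarith
  calc y ^ 2 * tailSlope y ≤ y ^ 2 * (2 * (y * stdNormalDensity y)) := by gcongr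
    _ ≤ y ^ 2 * (2 * (y * Real.exp (-y))) := by gcongr
    _ = _ := by ring

lemma hasDerivAt_Ffun (δ s : ℝ) {τ : ℝ} (hτ : 0 < τ) :
    HasDerivAt (Ffun δ s) (δ - 1 / 2 - 1 / s / τ ^ 2 + tailSlope (2 / τ)) τ := by
  have hτ' := hτ.ne'
  have hdiv : ∀ k : ℝ, HasDerivAt (fun t : ℝ => k / t) (-k / τ ^ 2) τ := fun k => by
    simpa using (hasDerivAt_const τ k).fun_div (hasDerivAt_id' τ) hτ'
  have hQ : HasDerivAt (fun t => Qfun (2 / t)) (-stdNormalDensity (2 / τ) * (-2 / τ ^ 2)) τ :=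
    (hasDerivAt_Qfun (2 / τ)).comp τ (hdiv 2)
  have hφ : HasDerivAt (fun t => 2 * stdNormalDensity (2 / t))
      (2 * (-(2 / τ * stdNormalDensity (2 / τ)) * (-2 / τ ^ 2))) τ :=
    ((hasDerivAt_stdNormalDensity (2 / τ)).comp τ (hdiv 2)).const_mul 2
  have hsqrt : Real.sqrt (2 / Real.pi) = 2 * (Real.sqrt (2 * Real.pi))⁻¹ := by
    rw [Real.sqrt_eq_iff_mul_self_eq (by positivity) (by positivity)]
    have := Real.mul_self_sqrt (show 0 ≤ 2 * Real.pi by positivity)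
    symm
    calc 2 * (√(2 * π))⁻¹ * (2 * (√(2 * π))⁻¹) = 4 * (√(2 * π) * √(2 * π))⁻¹ := by
          rw [mul_inv]; ring
      _ = _ := by rw [this]; field_simp; norm_num
  have hF : Ffun δ s = fun t => t * (δ - 1 / 2) + (1 / s) / t + (t + 4 / t) * Qfun (2 / t)
      - 2 * stdNormalDensity (2 / t) := by
    funext t
    unfold Ffun stdNormalDensity
    rw [hsqrt, show -(2 / t) ^ 2 / 2 = -2 / t ^ 2 by ring]
    ring
  rw [hF]
  refine (((((hasDerivAt_id' τ).mul_const (δ - 1 / 2)).add (hdiv (1 / s))).add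
    (((hasDerivAt_id' τ).add (hdiv 4)).mul hQ)).sub hφ).congr_deriv ?_
  simp only [tailSlope, Pi.add_apply]
  field_simp
  ring

lemma inv_sq_eq_of_isMin_Ffun {δ s τ : ℝ} (hs : 0 < s) (hτ : 0 < τ)
    (hmin : ∀ t : ℝ, 0 < t → Ffun δ s τ ≤ Ffun δ s t) :
    (1 / τ) ^ 2 = s * (δ - 1 / 2 + tailSlope (2 * (1 / τ))) := by
  have hloc : IsLocalMin (Ffun δ s) τ := by
    filter_upwards [lt_mem_nhds hτ] with t ht using hmin t ht
  have h := hloc.hasDerivAt_eq_zero (hasDerivAt_Ffun δ s hτ)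
  rw [mul_one_div]
  have h' : δ - 1 / 2 + tailSlope (2 / τ) = 1 / s / τ ^ 2 := by linarith
  rw [h']
  field_simp

theorem stmt14 (δ : ℝ) (hδ : 1 / 2 < δ)
    (τs : ℝ → ℝ) (hτs : ∀ s : ℝ, 0 < s → 0 < τs s)
    (hmin : ∀ s : ℝ, 0 < s → ∀ τ : ℝ, 0 < τ → Ffun δ s (τs s) ≤ Ffun δ s τ) :
    Filter.Tendsto (fun s => Qfun (1 / τs s) / Qfun (Real.sqrt ((δ - 1 / 2) * s)))
      Filter.atTop (nhds 1) ∧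
    ∀ ε : ℝ, 0 < ε → ∃ SNR₀ : ℝ, ∀ s : ℝ, SNR₀ ≤ s →
      |Qfun (1 / τs s) / Qfun (Real.sqrt ((δ - 1 / 2) * s)) - 1| ≤ ε := by
  have hc : 0 < δ - 1 / 2 := by linarith
  have hlim : Filter.Tendsto (fun s => Real.sqrt ((δ - 1 / 2) * s)) Filter.atTop Filter.atTop :=
    Real.tendsto_sqrt_atTop.comp (Filter.tendsto_id.const_mul_atTop hc)
  have hle : ∀ s, 0 < s → Real.sqrt ((δ - 1 / 2) * s) ≤ 1 / τs s := fun s hs => by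
    have hτ := hτs s hs
    have heq := inv_sq_eq_of_isMin_Ffun hs hτ (hmin s hs)
    have hH := tailSlope_nonneg (y := 2 * (1 / τs s)) (by positivity)
    refine Real.sqrt_le_iff.2 ⟨by positivity, ?_⟩
    rw [heq]
    nlinarith [mul_nonneg hs.le hH]
  have hx : Filter.Tendsto (fun s => 2 * (1 / τs s)) Filter.atTop Filter.atTop :=
    (Filter.tendsto_atTop_mono' _ ((Filter.eventually_gt_atTop 0).mono hle) hlim).const_mul_atTop
      two_pos
  have hbound : ∀ᶠ s in Filter.atTop,
      ‖Qfun (1 / τs s) / Qfun (Real.sqrt ((δ - 1 / 2) * s)) - 1‖ ≤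
        Real.exp (3 / 2) * (2 * (δ - 1 / 2))⁻¹ *
          ((2 * (1 / τs s)) ^ 3 * Real.exp (-(2 * (1 / τs s)))) := by
    filter_upwards [Filter.eventually_gt_atTop 0, hlim.eventually_ge_atTop 1] with s hs ha
    have hax := hle s hs
    have heq := inv_sq_eq_of_isMin_Ffun hs (hτs s hs) (hmin s hs)
    set x := 1 / τs s
    have hH := tailSlope_nonneg (y := 2 * x) (by linarith)
    have hu := sq_mul_tailSlope_le (y := 2 * x) (by linarith)
    rw [Real.norm_eq_abs]
    refine (abs_Qfun_div_Qfun_sub_one_le ha hax).trans ?_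
    rw [mul_assoc, Real.sq_sqrt (by positivity)]
    gcongr
    rw [inv_mul_eq_div, le_div_iff₀ (by positivity)]
    have hsx : s * (δ - 1 / 2) ≤ x ^ 2 := by nlinarith [mul_nonneg hs.le hH]
    calc (x ^ 2 - (δ - 1 / 2) * s) * (2 * (δ - 1 / 2))
        = 2 * (s * (δ - 1 / 2)) * tailSlope (2 * x) := by rw [heq]; ring
      _ ≤ 2 * x ^ 2 * tailSlope (2 * x) := by gcongr
      _ ≤ _ := by linarith
  have hzero : Filter.Tendsto (fun s => Real.exp (3 / 2) * (2 * (δ - 1 / 2))⁻¹ *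
      ((2 * (1 / τs s)) ^ 3 * Real.exp (-(2 * (1 / τs s))))) Filter.atTop (nhds 0) := by
    simpa only [mul_zero, Function.comp_def] using
      ((Real.tendsto_pow_mul_exp_neg_atTop_nhds_zero 3).comp hx).const_mul
        (Real.exp (3 / 2) * (2 * (δ - 1 / 2))⁻¹)
  have hmain := tendsto_sub_nhds_zero_iff.1 (squeeze_zero_norm' hbound hzero)
  refine ⟨hmain, fun ε hε => ?_⟩
  obtain ⟨N, hN⟩ := Metric.tendsto_atTop.1 hmain ε hε
  exact ⟨N, fun s hs => (hN s hs).le⟩
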